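/- Let l ≥ 2, let ξ ∈ V_l ⊖ S_l, and let m ≥ 0, n ≥ 0 be integers. Then in ℓ²(W): h(ξ_{m,n}) = ξ_{m+1,n} + p·ξ_{m,n} + (L−1)·ξ_{m−1,n} (with ξ_{−1,n} = 0). -/

import Mathlib

noncomputable section

open scoped ComplexInnerProductSpace

namespace UCoxMasa

/-- The universal Coxeter matrix on `Fin L`: all off-diagonal entries are `0` (representing ∞). -/
def Mat (L : ℕ) : CoxeterMatrix (Fin L) where
  M := fun i j => if i = j then 1 else 0
  isSymm := by
    ext i j
    by_cases h : i = j <;> simp [Matrix.transpose, h, eq_comm]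
  diagonal := fun i => by simp
  off_diagonal := fun i j h => by simp [h]

/-- The universal Coxeter group on `L` generators: free product of `L` copies of `ℤ/2ℤ`. -/
abbrev W (L : ℕ) : Type := (Mat L).Group

/-- The distinguished Coxeter system of `W L`. -/
def cs (L : ℕ) : CoxeterSystem (Mat L) (W L) := CoxeterMatrix.toCoxeterSystem (Mat L)

/-- The simple reflection associated to `i : Fin L`. -/
def σ {L : ℕ} (i : Fin L) : W L := (cs L).simple i

/-- Word length on `W L` with respect to the generating set of simple reflections. -/
def len {L : ℕ} (w : W L) : ℕ := (cs L).length w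

/-- The Hilbert space `ℓ²(W)`. -/
abbrev H (L : ℕ) : Type := lp (fun _ : W L => ℂ) 2

/-- The standard orthonormal basis vector `δ_w` of `ℓ²(W)`. -/
def δ {L : ℕ} (w : W L) : H L :=
  letI := Classical.decEq (W L)
  lp.single 2 w 1

/-- `V l`: the linear span of `{δ_w : ℓ(w) = l}`. -/
def V (L : ℕ) (l : ℕ) : Submodule ℂ (H L) :=
  Submodule.span ℂ {x : H L | ∃ w : W L, len w = l ∧ x = δ w}

/-- `S_l`: the linear span of `q_l(h V_{l-1}) ∪ q_l(R_h V_{l-1})`,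
given the projections `Q`, the operator `h` and the right operator `Rh`. -/
def Sl (L : ℕ) (Q : ℕ → (H L →L[ℂ] H L)) (h Rh : H L →L[ℂ] H L) (l : ℕ) :
    Submodule ℂ (H L) :=
  Submodule.span ℂ
    ({x : H L | ∃ y ∈ V L (l - 1), x = Q l (h y)} ∪
      {x : H L | ∃ y ∈ V L (l - 1), x = Q l (Rh y)})

end UCoxMasa

namespace UCoxMasa

/-- Left multiplication by the generator `s` on words without equal neighbours. -/
def consCancel {L : ℕ} (s : Fin L) : List (Fin L) → List (Fin L)
  | [] => [s]
  | a :: l => if a = s then l else s :: a :: l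

lemma isChain_consCancel {L : ℕ} (s : Fin L) {l : List (Fin L)} (hl : l.IsChain (· ≠ ·)) :
    (consCancel s l).IsChain (· ≠ ·) := by
  cases l with
  | nil => simp [consCancel]
  | cons a l =>
    simp only [consCancel]
    split_ifs with h
    · exact hl.tail
    · exact List.isChain_cons_cons.2 ⟨fun e => h e.symm, hl⟩

lemma consCancel_eq_cons {L : ℕ} {s : Fin L} {l : List (Fin L)}
    (hl : (s :: l).IsChain (· ≠ ·)) : consCancel s l = s :: l := by
  cases l with
  | nil => rfl
  | cons a l => exact if_neg fun e => (List.isChain_cons_cons.1 hl).1 e.symm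

lemma consCancel_consCancel {L : ℕ} (s : Fin L) {l : List (Fin L)} (hl : l.IsChain (· ≠ ·)) :
    consCancel s (consCancel s l) = l := by
  cases l with
  | nil => simp [consCancel]
  | cons a l =>
    by_cases h : a = s
    · subst h
      rw [show consCancel a (a :: l) = l from if_pos rfl, consCancel_eq_cons hl]
    · rw [show consCancel s (a :: l) = s :: a :: l from if_neg h]
      exact if_pos rfl

/-- The generator `s` as a self-map of the set of words without equal neighbours. -/
def wordEnd {L : ℕ} (s : Fin L) :
    Function.End {l : List (Fin L) // l.IsChain (· ≠ ·)} :=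
  fun l => ⟨consCancel s l.1, isChain_consCancel s l.2⟩

lemma wordEnd_isLiftable (L : ℕ) : (Mat L).IsLiftable (wordEnd (L := L)) := by
  intro i j
  by_cases h : i = j
  · subst h
    have : (Mat L).M i i = 1 := by simp [Mat]
    rw [this, pow_one]
    funext l
    exact Subtype.ext (consCancel_consCancel i l.2)
  · have : (Mat L).M i j = 0 := by simp [Mat, h]
    rw [this, pow_zero]

/-- The action of `W L` on the words without equal neighbours. -/
def wordAction (L : ℕ) : W L →* Function.End {l : List (Fin L) // l.IsChain (· ≠ ·)} :=
  (cs L).lift ⟨wordEnd, wordEnd_isLiftable L⟩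

lemma wordAction_wordProd {L : ℕ} (l : List (Fin L)) (hl : l.IsChain (· ≠ ·)) :
    wordAction L ((cs L).wordProd l) ⟨[], by simp⟩ = ⟨l, hl⟩ := by
  induction l with
  | nil => simp; rfl
  | cons a l ih =>
    rw [CoxeterSystem.wordProd_cons, map_mul]
    change wordAction L ((cs L).simple a) (wordAction L ((cs L).wordProd l) _) = _
    rw [ih hl.tail, wordAction, CoxeterSystem.lift_apply_simple _ (wordEnd_isLiftable L)]
    exact Subtype.ext (consCancel_eq_cons hl)

lemma isChain_of_isReduced {L : ℕ} {l : List (Fin L)} (hl : (cs L).IsReduced l) :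
    l.IsChain (· ≠ ·) := by
  induction l with
  | nil => simp
  | cons a l ih =>
    have ih := ih (by simpa using hl.drop 1)
    cases l with
    | nil => simp
    | cons b l =>
      refine List.isChain_cons_cons.2 ⟨?_, ih⟩
      rintro rfl
      have h1 := hl.eq
      rw [CoxeterSystem.wordProd_cons, CoxeterSystem.wordProd_cons,
        CoxeterSystem.simple_mul_simple_cancel_left] at h1
      have h2 := (cs L).length_wordProd_le l
      simp at h1
      omega

lemma exists_isReduced_cons_of_descent {L : ℕ} {s : Fin L} {w : W L}
    (h : len (σ s * w) < len w) :
    ∃ l, (cs L).IsReduced (s :: l) ∧ w = (cs L).wordProd (s :: l) := by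
  obtain ⟨l, hl, hw⟩ := (cs L).exists_isReduced (σ s * w)
  have e : w = (cs L).wordProd (s :: l) := by
    rw [CoxeterSystem.wordProd_cons, ← hw]
    exact ((cs L).simple_mul_simple_cancel_left s).symm
  refine ⟨l, ?_, e⟩
  have h1 := (cs L).isLeftDescent_iff.1 h
  have h2 := hl.eq
  rw [← hw] at h2
  change _ = _
  rw [← e, ← h1, List.length_cons, ← h2]
  rfl

lemma leftDescent_unique {L : ℕ} {s t : Fin L} {w : W L}
    (hs : len (σ s * w) < len w) (ht : len (σ t * w) < len w) : s = t := by
  obtain ⟨l, hl, e⟩ := exists_isReduced_cons_of_descent hs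
  obtain ⟨l', hl', e'⟩ := exists_isReduced_cons_of_descent ht
  have h1 := wordAction_wordProd _ (isChain_of_isReduced hl)
  have h2 := wordAction_wordProd _ (isChain_of_isReduced hl')
  rw [← e] at h1
  rw [← e', h1] at h2
  have := congrArg Subtype.val h2
  simp only [List.cons.injEq] at this
  exact this.1

/-- The properties of the multiplication of `W L` and of its opposite which govern the action
of the generators on the vectors `δ w`. -/
structure IsLengthMul {L : ℕ} (μ : W L → W L → W L) : Prop where
  assoc (a b c : W L) : μ (μ a b) c = μ a (μ b c)
  one_mul (a : W L) : μ 1 a = a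
  cancel (s : Fin L) (a : W L) : μ (σ s) (μ (σ s) a) = a
  len_mul_le (a b : W L) : len (μ a b) ≤ len a + len b
  len_simple (s : Fin L) (a : W L) : len (μ (σ s) a) = len a + 1 ∨ len (μ (σ s) a) + 1 = len a
  exists_descent (a : W L) (ha : len a ≠ 0) : ∃ s, len (μ (σ s) a) < len a
  descent_unique (s t : Fin L) (a : W L) (hs : len (μ (σ s) a) < len a)
    (ht : len (μ (σ t) a) < len a) : s = t

lemma len_eq_zero {L : ℕ} {w : W L} : len w = 0 ↔ w = 1 := (cs L).length_eq_zero_iff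

lemma len_mul_simple {L : ℕ} (w : W L) (s : Fin L) : len (w * σ s) = len (σ s * w⁻¹) := by
  unfold len
  rw [← (cs L).length_inv, mul_inv_rev]
  congr 2
  exact (cs L).inv_simple s

lemma isLengthMul_mul (L : ℕ) : IsLengthMul (fun a b : W L => a * b) where
  assoc := mul_assoc
  one_mul := one_mul
  cancel s _ := (cs L).simple_mul_simple_cancel_left s
  len_mul_le := (cs L).length_mul_le
  len_simple s a := (cs L).length_simple_mul a s
  exists_descent _ ha := (cs L).exists_leftDescent_of_ne_one fun h => ha (len_eq_zero.2 h)
  descent_unique _ _ _ := leftDescent_unique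

lemma isLengthMul_op (L : ℕ) : IsLengthMul (fun a b : W L => b * a) where
  assoc a b c := (mul_assoc c b a).symm
  one_mul := mul_one
  cancel s _ := (cs L).simple_mul_simple_cancel_right s
  len_mul_le a b := ((cs L).length_mul_le b a).trans_eq (add_comm _ _)
  len_simple s a := (cs L).length_mul_simple a s
  exists_descent _ ha := (cs L).exists_rightDescent_of_ne_one fun h => ha (len_eq_zero.2 h)
  descent_unique s t a hs ht := by
    have e : len a⁻¹ = len a := (cs L).length_inv a
    rw [len_mul_simple, ← e] at hs ht
    exact leftDescent_unique hs ht

lemma finite_sphere (L n : ℕ) : {w : W L | len w = n}.Finite := by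
  refine ((List.finite_length_eq (Fin L) n).image (cs L).wordProd).subset ?_
  intro w hw
  obtain ⟨l, hl, e⟩ := (cs L).exists_isReduced w
  refine ⟨l, ?_, e.symm⟩
  have := hl.eq
  rw [← e] at this
  exact this.symm.trans hw

/-- The sphere of radius `n` in `W L`. -/
def sphere (L n : ℕ) : Finset (W L) := (finite_sphere L n).toFinset

lemma mem_sphere {L n : ℕ} {w : W L} : w ∈ sphere L n ↔ len w = n := by
  simp [sphere]

lemma tsum_sphere {L : ℕ} (A : W L → H L →L[ℂ] H L) (n : ℕ) :
    ∑' w : {w : W L // len w = n}, A w = ∑ w ∈ sphere L n, A w := by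
  have : {w : W L | len w = n} = ↑(sphere L n) := by ext; simp [mem_sphere]
  change ∑' w : ({w : W L | len w = n} : Set (W L)), A w = _
  rw [this, Finset.tsum_subtype']

lemma sum_sphere_succ {L : ℕ} {E : Type*} [AddCommMonoid E] {μ : W L → W L → W L}
    (hμ : IsLengthMul μ) (f : W L → E) (n : ℕ) :
    ∑ w ∈ sphere L (n + 1), f w =
      ∑ s, ∑ u ∈ sphere L n, if len (μ (σ s) u) = n + 1 then f (μ (σ s) u) else 0 := by
  have key (s : Fin L) :
      (∑ u ∈ sphere L n, if len (μ (σ s) u) = n + 1 then f (μ (σ s) u) else 0) =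
        ∑ w ∈ sphere L (n + 1), if len (μ (σ s) w) = n then f w else 0 := by
    rw [← Finset.sum_filter, ← Finset.sum_filter]
    refine Finset.sum_nbij' (μ (σ s)) (μ (σ s)) ?_ ?_ ?_ ?_ ?_ <;>
      simp +contextual [mem_sphere, hμ.cancel]
  simp_rw [key]
  rw [Finset.sum_comm]
  refine Finset.sum_congr rfl fun w hw => ?_
  rw [mem_sphere] at hw
  obtain ⟨s, hs⟩ := hμ.exists_descent w (by omega)
  rw [Finset.sum_eq_single s]
  · have := hμ.len_simple s w
    rw [if_pos (by omega)]
  · intro t _ hts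
    refine if_neg fun h => hts (hμ.descent_unique t s w (by omega) hs)
  · simp

/-- The span of the vectors `δ w` with `len w < k`. -/
def lower (L k : ℕ) : Submodule ℂ (H L) :=
  Submodule.span ℂ {x : H L | ∃ w : W L, len w < k ∧ x = δ w}

lemma delta_mem_lower {L k : ℕ} {w : W L} (h : len w < k) : δ w ∈ lower L k :=
  Submodule.subset_span ⟨w, h, rfl⟩

lemma delta_mem_V {L k : ℕ} {w : W L} (h : len w = k) : δ w ∈ V L k :=
  Submodule.subset_span ⟨w, h, rfl⟩

lemma lower_mono {L j k : ℕ} (h : j ≤ k) : lower L j ≤ lower L k :=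
  Submodule.span_mono fun _ ⟨w, hw, e⟩ => ⟨w, hw.trans_le h, e⟩

lemma V_le_lower {L j k : ℕ} (h : j < k) : V L j ≤ lower L k :=
  Submodule.span_mono fun _ ⟨w, hw, e⟩ => ⟨w, hw.trans_lt h, e⟩

lemma map_mem_of_lower {L k : ℕ} {A : H L →L[ℂ] H L} {P : Submodule ℂ (H L)}
    (hA : ∀ w, len w < k → A (δ w) ∈ P) {y : H L} (hy : y ∈ lower L k) : A y ∈ P := by
  have : lower L k ≤ P.comap (A : H L →ₗ[ℂ] H L) := by
    refine Submodule.span_le.2 ?_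
    rintro _ ⟨w, hw, rfl⟩
    exact hA w hw
  exact this hy

lemma eq_of_eq_on_delta {L k : ℕ} {A B : H L →L[ℂ] H L}
    (h : ∀ w, len w = k → A (δ w) = B (δ w)) {y : H L} (hy : y ∈ V L k) : A y = B y := by
  refine LinearMap.eqOn_span (f := (A : H L →ₗ[ℂ] H L)) (g := (B : H L →ₗ[ℂ] H L)) ?_ hy
  rintro _ ⟨w, hw, rfl⟩
  exact h w hw

/-- `Q k` is the orthogonal projection onto `V L k`, described on the basis `δ`. -/
def IsProj {L : ℕ} (Q : ℕ → H L →L[ℂ] H L) : Prop :=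
  ∀ (k : ℕ) (w : W L), Q k (δ w) = if len w = k then δ w else 0

namespace IsProj

variable {L : ℕ} {Q : ℕ → H L →L[ℂ] H L}

lemma apply_lower (hQ : IsProj Q) {k : ℕ} {y : H L} (hy : y ∈ lower L k) : Q k y = 0 := by
  refine (Submodule.mem_bot ℂ).1 (map_mem_of_lower (fun w hw => ?_) hy)
  rw [hQ, if_neg hw.ne]
  exact zero_mem _

lemma apply_V (hQ : IsProj Q) {k : ℕ} {y : H L} (hy : y ∈ V L k) : Q k y = y :=
  eq_of_eq_on_delta (B := ContinuousLinearMap.id ℂ (H L)) (fun w hw => by simp [hQ k w, hw]) hy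

lemma sub_apply_mem (hQ : IsProj Q) {k : ℕ} {y : H L} (hy : y ∈ lower L (k + 1)) :
    y - Q k y ∈ lower L k := by
  refine map_mem_of_lower (A := ContinuousLinearMap.id ℂ (H L) - Q k) (fun w hw => ?_) hy
  simp only [sub_apply, ContinuousLinearMap.id_apply, hQ k w]
  split_ifs with h
  · simp
  · rw [sub_zero]
    exact delta_mem_lower (by omega)

lemma apply_mem (hQ : IsProj Q) {j k : ℕ} {y : H L} (hy : y ∈ lower L j) :
    Q k y ∈ V L k := by
  refine map_mem_of_lower (fun w hw => ?_) hy
  rw [hQ]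
  split_ifs with h
  · exact delta_mem_V h
  · exact zero_mem _

lemma congr_of_sub_mem (hQ : IsProj Q) {k : ℕ} {y z : H L} (h : y - z ∈ lower L k) :
    Q k y = Q k z := by
  rw [← sub_eq_zero, ← map_sub]
  exact hQ.apply_lower h

end IsProj

/-- The operators `T s` are the Hecke operators attached to the multiplication `μ`. -/
def IsHecke {L : ℕ} (μ : W L → W L → W L) (p : ℂ) (T : Fin L → H L →L[ℂ] H L) : Prop :=
  ∀ (s : Fin L) (w : W L), T s (δ w) =
    if len (μ (σ s) w) < len w then δ (μ (σ s) w) + p • δ w else δ (μ (σ s) w)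

/-- The operators `A w` are the products of the operators `T s` along reduced words. -/
structure IsHeckeBasis {L : ℕ} (μ : W L → W L → W L) (T : Fin L → H L →L[ℂ] H L)
    (A : W L → H L →L[ℂ] H L) : Prop where
  one : A 1 = 1
  rec_eq (s : Fin L) (w : W L) (h : len (μ (σ s) w) < len w) : A w = T s ∘L A (μ (σ s) w)

section Hecke

variable {L : ℕ} {μ : W L → W L → W L} {p : ℂ} {T : Fin L → H L →L[ℂ] H L}
  {A : W L → H L →L[ℂ] H L} {Q : ℕ → H L →L[ℂ] H L}

lemma IsHecke.sub_delta_mem (hT : IsHecke μ p T) (s : Fin L) (x : W L) :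
    T s (δ x) - δ (μ (σ s) x) ∈ lower L (len x + 1) := by
  rw [hT s x]
  split_ifs
  · rw [add_sub_cancel_left]
    exact Submodule.smul_mem _ _ (delta_mem_lower (by omega))
  · rw [sub_self]
    exact zero_mem _

lemma IsHecke.apply_lower (hμ : IsLengthMul μ) (hT : IsHecke μ p T) (s : Fin L) {k : ℕ} {y : H L}
    (hy : y ∈ lower L k) : T s y ∈ lower L (k + 1) := by
  refine map_mem_of_lower (fun w hw => ?_) hy
  rw [← sub_add_cancel (T s (δ w)) (δ (μ (σ s) w))]
  refine add_mem (lower_mono (by omega) (hT.sub_delta_mem s w)) (delta_mem_lower ?_)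
  have := hμ.len_simple s w
  omega

lemma IsHecke.sum_apply_lower (hμ : IsLengthMul μ) (hT : IsHecke μ p T) {k : ℕ} {y : H L}
    (hy : y ∈ lower L k) : (∑ s, T s) y ∈ lower L (k + 1) := by
  rw [sum_apply]
  exact sum_mem fun s _ => hT.apply_lower hμ s hy

lemma IsHecke.proj_apply_delta (hT : IsHecke μ p T) (hQ : IsProj Q) (s : Fin L) {x : W L} {j : ℕ}
    (h : len x ≠ j) :
    Q j (T s (δ x)) = if len (μ (σ s) x) = j then δ (μ (σ s) x) else 0 := by
  rw [hT s x, apply_ite (Q j), map_add, map_smul, hQ j x, if_neg h, smul_zero, add_zero, ite_self,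
    hQ]

lemma IsHecke.proj_sum_apply_delta (hT : IsHecke μ p T) (hQ : IsProj Q) {x : W L} {j : ℕ}
    (h : len x ≠ j) :
    Q j ((∑ s, T s) (δ x)) = ∑ s, if len (μ (σ s) x) = j then δ (μ (σ s) x) else 0 := by
  rw [sum_apply, map_sum]
  exact Finset.sum_congr rfl fun s _ => hT.proj_apply_delta hQ s h

lemma IsHeckeBasis.sub_delta_mem (hμ : IsLengthMul μ) (hT : IsHecke μ p T)
    (hA : IsHeckeBasis μ T A) (w x : W L) :
    A w (δ x) - δ (μ w x) ∈ lower L (len w + len x) := by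
  induction hk : len w generalizing w with
  | zero =>
    rw [len_eq_zero.1 hk, hA.one, hμ.one_mul]
    simp
  | succ k ih =>
    obtain ⟨s, hs⟩ := hμ.exists_descent w (by omega)
    have hlen := hμ.len_simple s w
    set u := μ (σ s) w with hu
    have hw : w = μ (σ s) u := (hμ.cancel s w).symm
    rw [hA.rec_eq s w hs, ← hu, ContinuousLinearMap.comp_apply,
      ← sub_add_sub_cancel _ (T s (δ (μ u x))), ← map_sub]
    refine add_mem ?_ ?_
    · have := hT.apply_lower hμ s (ih u (by omega))
      exact lower_mono (by omega) this
    · have hmem := hT.sub_delta_mem s (μ u x)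
      rw [← hμ.assoc, ← hw] at hmem
      have := hμ.len_mul_le u x
      exact lower_mono (by omega) hmem

lemma IsHeckeBasis.apply_lower (hμ : IsLengthMul μ) (hT : IsHecke μ p T)
    (hA : IsHeckeBasis μ T A) (w : W L) {k : ℕ} {y : H L} (hy : y ∈ lower L k) :
    A w y ∈ lower L (len w + k) := by
  refine map_mem_of_lower (fun x hx => ?_) hy
  rw [← sub_add_cancel (A w (δ x)) (δ (μ w x))]
  refine add_mem (lower_mono (by omega) (hA.sub_delta_mem hμ hT w x)) (delta_mem_lower ?_)
  have := hμ.len_mul_le w x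
  omega

lemma IsHeckeBasis.sum_sphere_apply_lower (hμ : IsLengthMul μ) (hT : IsHecke μ p T)
    (hA : IsHeckeBasis μ T A) (m : ℕ) {k : ℕ} {y : H L} (hy : y ∈ lower L k) :
    (∑ w ∈ sphere L m, A w) y ∈ lower L (m + k) := by
  rw [sum_apply]
  refine sum_mem fun w hw => ?_
  rw [← mem_sphere.1 hw]
  exact hA.apply_lower hμ hT w hy

lemma IsHeckeBasis.sum_sphere_zero (hA : IsHeckeBasis μ T A) : ∑ w ∈ sphere L 0, A w = 1 := by
  have : sphere L 0 = {1} := by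
    ext w
    simp [mem_sphere, len_eq_zero]
  rw [this, Finset.sum_singleton, hA.one]

lemma IsHeckeBasis.proj_sum_sphere_succ (hμ : IsLengthMul μ) (hT : IsHecke μ p T)
    (hA : IsHeckeBasis μ T A) (hQ : IsProj Q) (m k : ℕ) {y : H L} (hy : y ∈ V L k) :
    Q (m + 1 + k) ((∑ w ∈ sphere L (m + 1), A w) y) =
      Q (m + 1 + k) ((∑ s, T s) (Q (m + k) ((∑ w ∈ sphere L m, A w) y))) := by
  have hsum : (∑ w ∈ sphere L m, A w) y ∈ lower L (m + k + 1) :=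
    lower_mono (add_assoc m k 1).ge
      (hA.sum_sphere_apply_lower hμ hT m (V_le_lower (Nat.lt_add_one k) hy))
  have hlow := hT.sum_apply_lower hμ (hQ.sub_apply_mem hsum)
  rw [map_sub] at hlow
  rw [← hQ.congr_of_sub_mem (lower_mono (by omega) hlow)]
  refine eq_of_eq_on_delta (A := Q (m + 1 + k) ∘L ∑ w ∈ sphere L (m + 1), A w)
    (B := Q (m + 1 + k) ∘L (∑ s, T s) ∘L ∑ w ∈ sphere L m, A w) (fun x hx => ?_) hy
  simp only [ContinuousLinearMap.comp_apply, sum_apply, map_sum]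
  rw [sum_sphere_succ hμ, Finset.sum_comm]
  refine Finset.sum_congr rfl fun u hu => Finset.sum_congr rfl fun s _ => ?_
  rw [mem_sphere] at hu
  split_ifs with h
  · rw [hA.rec_eq s (μ (σ s) u) (by rw [hμ.cancel]; omega), hμ.cancel]
    rfl
  · have h1 := hμ.len_simple s u
    have h2 := hT.apply_lower hμ s (hA.sub_delta_mem hμ hT u x)
    rw [map_sub] at h2
    have h3 := hμ.len_mul_le (μ (σ s) u) x
    have h4 := hμ.len_mul_le u x
    rw [hQ.congr_of_sub_mem (lower_mono (by omega) h2),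
      hQ.congr_of_sub_mem (lower_mono (by omega) (hT.sub_delta_mem s (μ u x))),
      ← hμ.assoc, hQ, if_neg (by omega)]

lemma IsHecke.sum_apply_eq (hμ : IsLengthMul μ) (hT : IsHecke μ p T) (hQ : IsProj Q) {k : ℕ}
    {y : H L} (hy : y ∈ V L (k + 1)) :
    (∑ s, T s) y = Q (k + 2) ((∑ s, T s) y) + p • y + Q k ((∑ s, T s) y) := by
  refine eq_of_eq_on_delta (A := ∑ s, T s)
    (B := Q (k + 2) ∘L (∑ s, T s) + p • ContinuousLinearMap.id ℂ (H L) + Q k ∘L (∑ s, T s))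
    (fun x hx => ?_) hy
  simp only [add_apply, ContinuousLinearMap.comp_apply,
    smul_apply, ContinuousLinearMap.id_apply]
  rw [hT.proj_sum_apply_delta hQ (by omega), hT.proj_sum_apply_delta hQ (by omega)]
  obtain ⟨r, hr⟩ := hμ.exists_descent x (by omega)
  have e : p • δ x = ∑ s, if s = r then p • δ x else 0 := by simp
  rw [e, ← Finset.sum_add_distrib, ← Finset.sum_add_distrib, sum_apply]
  refine Finset.sum_congr rfl fun s _ => ?_
  rw [hT s x]
  have hs := hμ.len_simple s x
  by_cases h : s = r
  · subst h
    rw [if_pos hr, if_pos rfl, if_neg (by omega), if_pos (by omega), zero_add, add_comm]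
  · have h' : ¬ len (μ (σ s) x) < len x := fun h' => h (hμ.descent_unique s r x h' hr)
    rw [if_neg h', if_neg h, if_pos (by omega), if_neg (by omega), add_zero, add_zero]

lemma IsHecke.down_up (hμ : IsLengthMul μ) (hT : IsHecke μ p T) (hQ : IsProj Q) {k : ℕ}
    {y : H L} (hy : y ∈ V L (k + 1)) :
    Q (k + 1) ((∑ s, T s) (Q (k + 2) ((∑ s, T s) y))) = ((L : ℂ) - 1) • y := by
  refine eq_of_eq_on_delta (A := Q (k + 1) ∘L (∑ s, T s) ∘L Q (k + 2) ∘L (∑ s, T s))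
    (B := ((L : ℂ) - 1) • ContinuousLinearMap.id ℂ (H L)) (fun x hx => ?_) hy
  simp only [ContinuousLinearMap.comp_apply, smul_apply,
    ContinuousLinearMap.id_apply]
  rw [hT.proj_sum_apply_delta hQ (by omega)]
  obtain ⟨r, hr⟩ := hμ.exists_descent x (by omega)
  have e : ((L : ℂ) - 1) • δ x = ∑ s, (δ x - if s = r then δ x else 0) := by
    simp [sub_smul, ← Nat.cast_smul_eq_nsmul ℂ]
  rw [e, map_sum, map_sum]
  refine Finset.sum_congr rfl fun s _ => ?_
  have hs := hμ.len_simple s x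
  by_cases h : s = r
  · subst h
    rw [if_neg (by omega), if_pos rfl, map_zero, map_zero, sub_self]
  · have h' : ¬ len (μ (σ s) x) < len x := fun h' => h (hμ.descent_unique s r x h' hr)
    rw [if_pos (by omega), if_neg h, hT.proj_sum_apply_delta hQ (by omega),
      Finset.sum_eq_single s, hμ.cancel, if_pos hx, sub_zero]
    · intro t _ hts
      refine if_neg fun ht => hts (hμ.descent_unique t s (μ (σ s) x) (by omega) ?_)
      rw [hμ.cancel]
      omega
    · simp

end Hecke

open Classical in
lemma inner_delta_delta {L : ℕ} (x y : W L) : ⟪δ x, δ y⟫ = if x = y then (1 : ℂ) else 0 := by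
  unfold δ
  rw [lp.inner_single_left, lp.single_apply]
  by_cases h : x = y
  · subst h
    simp
  · simp [h]

lemma inner_proj_sum_left {L : ℕ} {μ : W L → W L → W L} {p : ℂ} {T : Fin L → H L →L[ℂ] H L}
    {Q : ℕ → H L →L[ℂ] H L} (hμ : IsLengthMul μ) (hT : IsHecke μ p T) (hQ : IsProj Q) {k : ℕ}
    {ξ : H L} (hξ : ξ ∈ V L (k + 1)) {y : W L} (hy : len y = k) :
    ⟪Q k ((∑ s, T s) ξ), δ y⟫ = ⟪ξ, Q (k + 1) ((∑ s, T s) (δ y))⟫ := by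
  induction hξ using Submodule.span_induction with
  | mem z hz =>
    obtain ⟨x, hx, rfl⟩ := hz
    rw [hT.proj_sum_apply_delta hQ (by omega), hT.proj_sum_apply_delta hQ (by omega), sum_inner,
      inner_sum]
    refine Finset.sum_congr rfl fun s _ => ?_
    rw [apply_ite (fun z => ⟪z, δ y⟫), apply_ite (fun z => ⟪δ x, z⟫), inner_delta_delta,
      inner_delta_delta, inner_zero_left, inner_zero_right]
    have h : μ (σ s) x = y ↔ x = μ (σ s) y :=
      ⟨fun e => by rw [← e, hμ.cancel], fun e => by rw [e, hμ.cancel]⟩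
    by_cases hxy : x = μ (σ s) y
    · have e := h.2 hxy
      rw [if_pos hxy, if_pos e, e, ← hxy, if_pos hy, if_pos hx]
    · rw [if_neg hxy, if_neg (mt h.1 hxy), ite_self, ite_self]
  | zero => simp
  | add a b _ _ ha hb => rw [map_add, map_add, inner_add_left, inner_add_left, ha, hb]
  | smul c a _ ha => rw [map_smul, map_smul, inner_smul_left, inner_smul_left, ha]

lemma proj_sum_eq_zero_of_perp {L : ℕ} {μ : W L → W L → W L} {p : ℂ} {T : Fin L → H L →L[ℂ] H L}
    {Q : ℕ → H L →L[ℂ] H L} (hμ : IsLengthMul μ) (hT : IsHecke μ p T) (hQ : IsProj Q) {k : ℕ}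
    {ξ : H L} (hξ : ξ ∈ V L (k + 1))
    (hperp : ∀ y ∈ V L k, ⟪ξ, Q (k + 1) ((∑ s, T s) y)⟫ = 0) :
    Q k ((∑ s, T s) ξ) = 0 := by
  have hmem : Q k ((∑ s, T s) ξ) ∈ V L k :=
    hQ.apply_mem (hT.sum_apply_lower hμ (V_le_lower (Nat.lt_add_one _) hξ))
  rw [← inner_self_eq_zero (𝕜 := ℂ)]
  have key : ∀ z ∈ V L k, ⟪Q k ((∑ s, T s) ξ), z⟫ = 0 := by
    intro z hz
    induction hz using Submodule.span_induction with
    | mem z hz =>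
      obtain ⟨y, hy, rfl⟩ := hz
      rw [inner_proj_sum_left hμ hT hQ hξ hy]
      exact hperp _ (delta_mem_V hy)
    | zero => simp
    | add a b _ _ ha hb => rw [inner_add_right, ha, hb, add_zero]
    | smul c a _ ha => rw [inner_smul_right, ha, mul_zero]
  exact key _ hmem

lemma descent_mul_simple_iff {L : ℕ} {x : W L} {k : ℕ} (hx : len x = k + 2) (s t : Fin L) :
    (len (x * σ t) = k + 3 ∧ len (σ s * (x * σ t)) = k + 2) ↔
      (len (σ s * x) = k + 1 ∧ len (σ s * (x * σ t)) = k + 2) := by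
  have hl := isLengthMul_mul L
  have hr := isLengthMul_op L
  -- a descent of `y` remains one after multiplying by a generator on the other side
  have key : ∀ (y : W L), len y ≠ 0 → len (y * σ t) = len y + 1 →
      len (σ s * (y * σ t)) < len (y * σ t) → len (σ s * y) < len y := by
    intro y hy h1 h2
    obtain ⟨r, hr'⟩ := hl.exists_descent y hy
    have h3 := hr.len_simple t (σ r * y)
    simp only [mul_assoc] at h3
    have : s = r := hl.descent_unique s r (y * σ t) h2 (by omega)
    rwa [this]
  refine and_congr_left fun h => ?_
  have h1 := hl.len_simple s x
  have h2 := hr.len_simple t x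
  constructor
  · intro h3
    have := key x (by omega) (by omega) (by omega)
    omega
  · intro h3
    by_contra h4
    have e : σ s * (σ s * x * σ t) = x * σ t := by rw [mul_assoc]; exact hl.cancel s (x * σ t)
    have := key (σ s * x) (by omega) (by rw [mul_assoc]; omega)
      (by rw [e, mul_assoc]; omega)
    have e' : σ s * (σ s * x) = x := hl.cancel s x
    rw [e'] at this
    omega

lemma down_rightUp {L : ℕ} {p : ℂ} {T Tr : Fin L → H L →L[ℂ] H L} {Q : ℕ → H L →L[ℂ] H L}
    (hT : IsHecke (fun a b : W L => a * b) p T) (hTr : IsHecke (fun a b : W L => b * a) p Tr)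
    (hQ : IsProj Q) {k : ℕ} {y : H L} (hy : y ∈ V L (k + 2)) :
    Q (k + 2) ((∑ s, T s) (Q (k + 3) ((∑ s, Tr s) y))) =
      Q (k + 2) ((∑ s, Tr s) (Q (k + 1) ((∑ s, T s) y))) := by
  refine eq_of_eq_on_delta (A := Q (k + 2) ∘L (∑ s, T s) ∘L Q (k + 3) ∘L (∑ s, Tr s))
    (B := Q (k + 2) ∘L (∑ s, Tr s) ∘L Q (k + 1) ∘L (∑ s, T s)) (fun x hx => ?_) hy
  simp only [ContinuousLinearMap.comp_apply]
  rw [hTr.proj_sum_apply_delta hQ (by omega), hT.proj_sum_apply_delta hQ (by omega)]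
  simp only [map_sum]
  have h1 (t : Fin L) : Q (k + 2) ((∑ s, T s) (if len (x * σ t) = k + 3 then δ (x * σ t) else 0)) =
      ∑ s, if len (x * σ t) = k + 3 ∧ len (σ s * (x * σ t)) = k + 2 then
        δ (σ s * (x * σ t)) else 0 := by
    by_cases h : len (x * σ t) = k + 3
    · rw [if_pos h, hT.proj_sum_apply_delta hQ (by omega)]
      simp [h]
    · simp [h]
  have h2 (s : Fin L) : Q (k + 2) ((∑ s, Tr s) (if len (σ s * x) = k + 1 then δ (σ s * x) else 0)) =
      ∑ t, if len (σ s * x) = k + 1 ∧ len (σ s * (x * σ t)) = k + 2 then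
        δ (σ s * (x * σ t)) else 0 := by
    by_cases h : len (σ s * x) = k + 1
    · rw [if_pos h, hTr.proj_sum_apply_delta hQ (by omega)]
      simp [h, mul_assoc]
    · simp [h]
  simp only [h1, h2]
  rw [Finset.sum_comm]
  simp only [descent_mul_simple_iff hx]

theorem statement5
    (L : ℕ) (hL : 3 ≤ L) (q p : ℝ) (hq : 0 < q) (hq1 : q ≤ 1)
    (hp : p = (q - 1) / Real.sqrt q)
    (T : Fin L → H L →L[ℂ] H L)
    (hT : ∀ (s : Fin L) (w : W L),
      T s (δ w) =
        if len (σ s * w) < len w then δ (σ s * w) + (p : ℂ) • δ w else δ (σ s * w))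
    (h : H L →L[ℂ] H L) (hh : h = ∑ s, T s)
    (Tw : W L → H L →L[ℂ] H L) (hTw1 : Tw 1 = 1)
    (hTwrec : ∀ (s : Fin L) (w : W L), len (σ s * w) < len w →
      Tw w = T s ∘L Tw (σ s * w))
    (hn : ℕ → H L →L[ℂ] H L)
    (hhn : ∀ n : ℕ, hn n = ∑' w : {w : W L // len w = n}, Tw (w : W L))
    (Tr : Fin L → H L →L[ℂ] H L)
    (hTr : ∀ (s : Fin L) (w : W L),
      Tr s (δ w) =
        if len (w * σ s) < len w then δ (w * σ s) + (p : ℂ) • δ w else δ (w * σ s))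
    (Rh : H L →L[ℂ] H L) (hRh : Rh = ∑ s, Tr s)
    (Twr : W L → H L →L[ℂ] H L) (hTwr1 : Twr 1 = 1)
    (hTwrrec : ∀ (s : Fin L) (w : W L), len (w * σ s) < len w →
      Twr w = Tr s ∘L Twr (w * σ s))
    (hnr : ℕ → H L →L[ℂ] H L)
    (hhnr : ∀ n : ℕ, hnr n = ∑' w : {w : W L // len w = n}, Twr (w : W L))
    (Q : ℕ → H L →L[ℂ] H L)
    (hQ : ∀ (l : ℕ) (w : W L), Q l (δ w) = if len w = l then δ w else 0)
    (l : ℕ) (hl : 2 ≤ l) (ξ : H L)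
    (hξmem : ξ ∈ V L l)
    (hξperp : ∀ y ∈ Sl L Q h Rh l, ⟪ξ, y⟫ = 0)
    (m n : ℕ) :
    h (Q (m + n + l) (hn m (hnr n ξ))) =
      Q (m + 1 + n + l) (hn (m + 1) (hnr n ξ)) +
        (p : ℂ) • Q (m + n + l) (hn m (hnr n ξ)) +
          ((L : ℂ) - 1) •
            (if m = 0 then 0 else Q (m - 1 + n + l) (hn (m - 1) (hnr n ξ))) := by
  obtain ⟨k, rfl⟩ : ∃ k, l = k + 2 := ⟨l - 2, by omega⟩
  have hμ := isLengthMul_mul L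
  have hμr := isLengthMul_op L
  have hTH : IsHecke (fun a b : W L => a * b) (p : ℂ) T := hT
  have hTrH : IsHecke (fun a b : W L => b * a) (p : ℂ) Tr := hTr
  have hA : IsHeckeBasis (fun a b : W L => a * b) T Tw := ⟨hTw1, hTwrec⟩
  have hAr : IsHeckeBasis (fun a b : W L => b * a) Tr Twr := ⟨hTwr1, hTwrrec⟩
  have hQP : IsProj Q := hQ
  have hn_eq (m : ℕ) : hn m = ∑ w ∈ sphere L m, Tw w := (hhn m).trans (tsum_sphere Tw m)
  have hnr_eq (m : ℕ) : hnr m = ∑ w ∈ sphere L m, Twr w := (hhnr m).trans (tsum_sphere Twr m)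
  have hr_low (j : ℕ) : hnr j ξ ∈ lower L (j + (k + 3)) := by
    rw [hnr_eq]
    exact hAr.sum_sphere_apply_lower hμr hTrH j (V_le_lower (by omega) hξmem)
  have hη_mem (j : ℕ) : Q (k + j + 2) (hnr j ξ) ∈ V L (k + j + 2) := hQP.apply_mem (hr_low j)
  have hdown (j : ℕ) : Q (k + j + 1) (h (Q (k + j + 2) (hnr j ξ))) = 0 := by
    induction j with
    | zero =>
      rw [hnr_eq, hAr.sum_sphere_zero, hh]
      change Q (k + 1) ((∑ s, T s) (Q (k + 2) ξ)) = 0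
      rw [hQP.apply_V hξmem]
      refine proj_sum_eq_zero_of_perp hμ hTH hQP hξmem fun y hy => hξperp _ ?_
      rw [← hh]
      exact Submodule.subset_span (Or.inl ⟨y, hy, rfl⟩)
    | succ j ih =>
      have e : Q (k + j + 3) (hnr (j + 1) ξ) =
          Q (k + j + 3) ((∑ s, Tr s) (Q (k + j + 2) (hnr j ξ))) := by
        have := hAr.proj_sum_sphere_succ hμr hTrH hQP j (k + 2) hξmem
        rw [← hnr_eq, ← hnr_eq, show j + 1 + (k + 2) = k + j + 3 by omega,
          show j + (k + 2) = k + j + 2 by omega] at this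
        exact this
      change Q (k + j + 2) (h (Q (k + j + 3) (hnr (j + 1) ξ))) = 0
      rw [e, hh, down_rightUp hTH hTrH hQP (hη_mem j), ← hh, ih, map_zero, map_zero]
  set η := Q (k + n + 2) (hnr n ξ) with hη
  have hmid (j : ℕ) :
      Q (k + n + j + 2) (hn j (hnr n ξ)) = Q (k + n + j + 2) (hn j η) := by
    refine hQP.congr_of_sub_mem ?_
    rw [← map_sub, hn_eq]
    have h1 : hnr n ξ - η ∈ lower L (k + n + 2) :=
      hQP.sub_apply_mem (lower_mono (by omega) (hr_low n))
    exact lower_mono (by omega) (hA.sum_sphere_apply_lower hμ hTH j h1)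
  have hZ_mem (j : ℕ) : Q (k + n + j + 2) (hn j η) ∈ V L (k + n + j + 2) := by
    rw [hn_eq]
    exact hQP.apply_mem
      (hA.sum_sphere_apply_lower hμ hTH j (V_le_lower (Nat.lt_add_one _) (hη_mem n)))
  have hZ_succ (j : ℕ) :
      Q (k + n + j + 3) (hn (j + 1) η) =
        Q (k + n + j + 3) (h (Q (k + n + j + 2) (hn j η))) := by
    have := hA.proj_sum_sphere_succ hμ hTH hQP j (k + n + 2) (hη_mem n)
    rw [← hn_eq, ← hn_eq, ← hh, show j + 1 + (k + n + 2) = k + n + j + 3 by omega,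
      show j + (k + n + 2) = k + n + j + 2 by omega] at this
    exact this
  have hsplit := hTH.sum_apply_eq hμ hQP (k := k + n + m + 1) (hZ_mem m)
  rw [← hh] at hsplit
  rw [show m + n + (k + 2) = k + n + m + 2 by omega,
    show m + 1 + n + (k + 2) = k + n + (m + 1) + 2 by omega, hmid, hmid]
  refine hsplit.trans ?_
  congr 1
  · congr 1
    exact (hZ_succ m).symm
  · cases m with
    | zero =>
      rw [if_pos rfl, smul_zero, hn_eq, hA.sum_sphere_zero]
      change Q (k + n + 1) (h (Q (k + n + 2) η)) = 0
      rw [hQP.apply_V (hη_mem n)]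
      exact hdown n
    | succ j =>
      rw [if_neg (Nat.succ_ne_zero j), Nat.add_sub_cancel,
        show j + n + (k + 2) = k + n + j + 2 by omega, hmid]
      have := hTH.down_up hμ hQP (k := k + n + j + 1) (hZ_mem j)
      rw [← hh] at this
      rw [← this]
      change Q (k + n + j + 2) (h (Q (k + n + j + 3) (hn (j + 1) η))) = _
      rw [hZ_succ]

end UCoxMasa
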